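/- arXiv:2202.12363 — 3 statements merged into one kernel-verified Lean document; each statement's English description precedes it below -/
import Mathlib

section
/- Let ν be a σ-finite measure on a measurable space 𝒳, and let G and H be probability measures on 𝒳 with densities g = g̃/Z_g and h = h̃/Z_h with respect to ν, where g̃, h̃ : 𝒳 → ℝ≥0 are measurable and Z_g, Z_h > 0 are real constants. Define w̃(x) := h̃(x)/g̃(x) for x with g̃(x) > 0 and w̃(x) := 1 for x with g̃(x) = 0. If G is absolutely continuous with respect to H and the Kullback–Leibler divergence KL(G ‖ H) is finite, then ∫_𝒳 log w̃ dG = log(Z_h/Z_g) − KL(G ‖ H). In particular, the log-space importance sampling estimator lower-bounds log(Z_h/Z_g) in expectation with gap exactly KL(G ‖ H). -/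
open MeasureTheory

/-- Log-space importance sampling estimator: if `G ≪ H`, with densities `g = g̃/Z_g` and
`h = h̃/Z_h` with respect to `ν` and `KL(G‖H) = ∫ log (g/h) g dν` finite, then the expected
log unnormalized weight `w̃ = h̃/g̃` satisfies
`∫ log w̃ dG = log (Z_h/Z_g) − KL(G‖H)`; in particular it lower-bounds `log (Z_h/Z_g)` with
gap exactly `KL(G‖H)`. -/
theorem expected_log_weight_eq_log_ratio_sub_kl
    {𝒳 : Type*} [MeasurableSpace 𝒳]
    (ν : Measure 𝒳) [SigmaFinite ν]
    (G H : Measure 𝒳) [IsProbabilityMeasure G] [IsProbabilityMeasure H]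
    (gt ht : 𝒳 → ℝ) (Zg Zh : ℝ)
    (hgt_meas : Measurable gt) (hgt_nonneg : ∀ x, 0 ≤ gt x)
    (hht_meas : Measurable ht) (hht_nonneg : ∀ x, 0 ≤ ht x)
    (hZg : 0 < Zg) (hZh : 0 < Zh)
    (hGdens : ∀ A : Set 𝒳, MeasurableSet A →
      G A = ∫⁻ x in A, ENNReal.ofReal (gt x / Zg) ∂ν)
    (hHdens : ∀ A : Set 𝒳, MeasurableSet A →
      H A = ∫⁻ x in A, ENNReal.ofReal (ht x / Zh) ∂ν)
    (wt : 𝒳 → ℝ) (hwt : ∀ x, wt x = if 0 < gt x then ht x / gt x else 1)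
    (hac : G ≪ H)
    (KL : ℝ)
    (hKL : KL = ∫ x, Real.log ((gt x / Zg) / (ht x / Zh)) * (gt x / Zg) ∂ν)
    (hKL_fin : Integrable (fun x => Real.log ((gt x / Zg) / (ht x / Zh)) * (gt x / Zg)) ν) :
    ∫ x, Real.log (wt x) ∂G = Real.log (Zh / Zg) - KL := by
  have hfm : Measurable fun x => ENNReal.ofReal (gt x / Zg) :=
    (hgt_meas.div_const Zg).ennreal_ofReal
  have hG : G = ν.withDensity fun x => ENNReal.ofReal (gt x / Zg) := by
    ext A hA
    rw [hGdens A hA, withDensity_apply _ hA]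
  have hlt : ∀ᵐ x ∂ν, ENNReal.ofReal (gt x / Zg) < ⊤ :=
    Filter.Eventually.of_forall fun x => ENNReal.ofReal_lt_top
  have htr : ∀ x, (ENNReal.ofReal (gt x / Zg)).toReal = gt x / Zg := fun x =>
    ENNReal.toReal_ofReal (div_nonneg (hgt_nonneg x) hZg.le)
  have hint : Integrable (fun x => Real.log ((gt x / Zg) / (ht x / Zh))) G := by
    rw [hG, integrable_withDensity_iff hfm hlt]
    simpa only [htr] using hKL_fin
  have hKL' : KL = ∫ x, Real.log ((gt x / Zg) / (ht x / Zh)) ∂G := by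
    rw [hKL, hG, integral_withDensity_eq_integral_toReal_smul hfm hlt]
    simp only [htr, smul_eq_mul, mul_comm]
  have key : ∀ f : 𝒳 → ℝ, Measurable f → (∀ x, 0 ≤ f x) → ∀ Z : ℝ, ∀ M : Measure 𝒳,
      (∀ A : Set 𝒳, MeasurableSet A → M A = ∫⁻ x in A, ENNReal.ofReal (f x / Z) ∂ν) →
      ∀ᵐ x ∂M, 0 < f x := by
    intro f hf h0 Z M hM
    have hs : MeasurableSet {x | f x = 0} := hf (measurableSet_singleton 0)
    have h1 : M {x | f x = 0} = 0 := by
      rw [hM _ hs, setLIntegral_congr_fun (g := fun _ => 0) hs]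
      · simp
      · intro x hx
        have hx' : f x = 0 := hx
        simp [hx']
    have h2 : ∀ᵐ x ∂M, ¬ f x = 0 := by
      rw [ae_iff]
      simpa using h1
    filter_upwards [h2] with x hx
    exact lt_of_le_of_ne (h0 x) (Ne.symm hx)
  have hg := key gt hgt_meas hgt_nonneg Zg G hGdens
  have hh := hac.ae_le (key ht hht_meas hht_nonneg Zh H hHdens)
  have hae : (fun x => Real.log (wt x)) =ᵐ[G]
      fun x => Real.log (Zh / Zg) - Real.log ((gt x / Zg) / (ht x / Zh)) := by
    filter_upwards [hg, hh] with x h1 h2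
    rw [hwt, if_pos h1, Real.log_div h2.ne' h1.ne', Real.log_div hZh.ne' hZg.ne',
      Real.log_div (div_pos h1 hZg).ne' (div_pos h2 hZh).ne',
      Real.log_div h1.ne' hZg.ne', Real.log_div h2.ne' hZh.ne']
    ring
  rw [integral_congr_ae hae, integral_sub (integrable_const _) hint, ← hKL']
  simp
end

section
/- Let ν be a σ-finite measure on a measurable space 𝒳, and let G and H be probability measures on 𝒳 with densities g = g̃/Z_g and h = h̃/Z_h with respect to ν, where g̃, h̃ : 𝒳 → ℝ≥0 are measurable and Z_g, Z_h > 0 are real constants. Define w̃(x) := h̃(x)/g̃(x) for x with g̃(x) > 0 and w̃(x) := 1 for x with g̃(x) = 0. If G and H are mutually absolutely continuous and KL(G ‖ H) is finite, then the mean absolute deviation of log w̃ under G satisfies ∫ |log w̃(x) − μ| G(dx) ≤ 2 + 2 KL(G ‖ H), where μ := ∫ log w̃ dG. -/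
open MeasureTheory

/-- Mean absolute deviation bound for the log unnormalized importance weight: with densities
`g = g̃/Z_g` and `h = h̃/Z_h` with respect to `ν`, unnormalized weight `w̃ = h̃/g̃` (set to
`1` where `g̃ = 0`), if `G` and `H` are mutually absolutely continuous and
`KL(G‖H) = ∫ log (g/h) g dν` is finite, then
`∫ |log w̃ − μ| dG ≤ 2 + 2 KL(G‖H)` where `μ = ∫ log w̃ dG`. -/
theorem mad_log_weight_le
    {𝒳 : Type*} [MeasurableSpace 𝒳]
    (ν : Measure 𝒳) [SigmaFinite ν]
    (G H : Measure 𝒳) [IsProbabilityMeasure G] [IsProbabilityMeasure H]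
    (gt ht : 𝒳 → ℝ) (Zg Zh : ℝ)
    (hgt_meas : Measurable gt) (hgt_nonneg : ∀ x, 0 ≤ gt x)
    (hht_meas : Measurable ht) (hht_nonneg : ∀ x, 0 ≤ ht x)
    (hZg : 0 < Zg) (hZh : 0 < Zh)
    (hGdens : ∀ A : Set 𝒳, MeasurableSet A →
      G A = ∫⁻ x in A, ENNReal.ofReal (gt x / Zg) ∂ν)
    (hHdens : ∀ A : Set 𝒳, MeasurableSet A →
      H A = ∫⁻ x in A, ENNReal.ofReal (ht x / Zh) ∂ν)
    (wt : 𝒳 → ℝ) (hwt : ∀ x, wt x = if 0 < gt x then ht x / gt x else 1)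
    (hGH : G ≪ H) (hHG : H ≪ G)
    (KL : ℝ)
    (hKL : KL = ∫ x, Real.log ((gt x / Zg) / (ht x / Zh)) * (gt x / Zg) ∂ν)
    (hKL_fin : Integrable (fun x => Real.log ((gt x / Zg) / (ht x / Zh)) * (gt x / Zg)) ν)
    (μ : ℝ) (hμ : μ = ∫ x, Real.log (wt x) ∂G) :
    ∫ x, |Real.log (wt x) - μ| ∂G ≤ 2 + 2 * KL := by
  have hg0 : ∀ x, 0 ≤ gt x / Zg := fun x => div_nonneg (hgt_nonneg x) hZg.le
  have hh0 : ∀ x, 0 ≤ ht x / Zh := fun x => div_nonneg (hht_nonneg x) hZh.le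
  have hgm : Measurable (fun x => gt x / Zg) := hgt_meas.div_const _
  have hhm : Measurable (fun x => ht x / Zh) := hht_meas.div_const _
  have hG : G = ν.withDensity (fun x => ENNReal.ofReal (gt x / Zg)) := by
    ext A hA
    rw [hGdens A hA, withDensity_apply _ hA]
  have key : ∀ (P : Measure 𝒳) (f : 𝒳 → ℝ) (Z : ℝ), Measurable f → (∀ x, 0 ≤ f x) →
      (∀ A : Set 𝒳, MeasurableSet A → P A = ∫⁻ x in A, ENNReal.ofReal (f x / Z) ∂ν) →
      ∀ᵐ x ∂P, 0 < f x := by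
    intro P f Z hf hf0 hP
    have hA : MeasurableSet {x | f x = 0} := hf (measurableSet_singleton 0)
    have h1 : P {x | f x = 0} = 0 := by
      rw [hP _ hA]
      rw [setLIntegral_congr_fun (g := fun _ => 0) hA]
      · simp
      · intro x hx
        have : f x = 0 := hx
        simp [this]
    have h2 : ∀ᵐ x ∂P, ¬ (f x = 0) := by
      rw [ae_iff]
      simpa using h1
    filter_upwards [h2] with x hx
    exact lt_of_le_of_ne (hf0 x) (Ne.symm hx)
  have hgpos : ∀ᵐ x ∂G, 0 < gt x := key G gt Zg hgt_meas hgt_nonneg hGdens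
  have hhpos : ∀ᵐ x ∂G, 0 < ht x := hGH.ae_le (key H ht Zh hht_meas hht_nonneg hHdens)
  set l : 𝒳 → ℝ := fun x => Real.log ((gt x / Zg) / (ht x / Zh)) with hl
  set r : 𝒳 → ℝ := fun x => (ht x / Zh) / (gt x / Zg) with hr
  have hrm : Measurable r := hhm.div hgm
  have hr0 : ∀ x, 0 ≤ r x := fun x => div_nonneg (hh0 x) (hg0 x)
  have hlint : Integrable l G := by
    rw [hG, integrable_withDensity_iff hgm.ennreal_ofReal (by simp)]
    refine hKL_fin.congr (Filter.Eventually.of_forall fun x => ?_)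
    simp only [ENNReal.toReal_ofReal (hg0 x), hl]
  have hKL' : ∫ x, l x ∂G = KL := by
    rw [hG, integral_withDensity_eq_integral_toReal_smul hgm.ennreal_ofReal (by simp), hKL]
    refine integral_congr_ae (Filter.Eventually.of_forall fun x => ?_)
    simp only [ENNReal.toReal_ofReal (hg0 x), smul_eq_mul, mul_comm, hl]
  have hrl : ∫⁻ x, ENNReal.ofReal (r x) ∂G ≤ 1 := by
    rw [hG, lintegral_withDensity_eq_lintegral_mul _ hgm.ennreal_ofReal hrm.ennreal_ofReal]
    calc _ ≤ ∫⁻ x, ENNReal.ofReal (ht x / Zh) ∂ν := by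
          refine lintegral_mono fun x => ?_
          simp only [Pi.mul_apply]
          rw [← ENNReal.ofReal_mul (hg0 x)]
          refine ENNReal.ofReal_le_ofReal ?_
          rcases (hg0 x).eq_or_lt with h | h
          · rw [← h, zero_mul]; exact hh0 x
          · exact (mul_div_cancel₀ _ h.ne').le
      _ = 1 := by
          have := hHdens Set.univ MeasurableSet.univ
          rw [Measure.restrict_univ, measure_univ] at this
          exact this.symm
  have hrint : Integrable r G := by
    refine ⟨hrm.aestronglyMeasurable, ?_⟩
    rw [hasFiniteIntegral_iff_ofReal (Filter.Eventually.of_forall hr0)]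
    exact hrl.trans_lt ENNReal.one_lt_top
  have hr1 : ∫ x, r x ∂G ≤ 1 := by
    rw [integral_eq_lintegral_of_nonneg_ae (Filter.Eventually.of_forall hr0)
      hrm.aestronglyMeasurable]
    exact ENNReal.toReal_le_of_le_ofReal zero_le_one (by simpa using hrl)
  have hbd : ∀ᵐ x ∂G, - l x ≤ r x - 1 := by
    filter_upwards [hgpos, hhpos] with x h1 h2
    have hp : 0 < r x := by simp only [hr]; positivity
    have : - l x = Real.log (r x) := by
      simp only [hl, hr]
      rw [← Real.log_inv, inv_div]
    rw [this]
    exact Real.log_le_sub_one_of_pos hp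
  have hKL0 : 0 ≤ KL := by
    have h := integral_mono_ae hlint.neg (hrint.sub (integrable_const 1)) hbd
    simp only [Pi.neg_apply, Pi.sub_apply] at h
    rw [integral_neg, integral_sub hrint (integrable_const 1), hKL'] at h
    simp at h
    linarith
  have hw : ∀ᵐ x ∂G, Real.log (wt x) = Real.log (Zh / Zg) - l x := by
    filter_upwards [hgpos, hhpos] with x h1 h2
    rw [hwt, if_pos h1]
    simp only [hl]
    rw [Real.log_div h2.ne' h1.ne', Real.log_div hZh.ne' hZg.ne',
      Real.log_div (by positivity) (by positivity), Real.log_div h1.ne' hZg.ne',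
      Real.log_div h2.ne' hZh.ne']
    ring
  have hμ' : μ = Real.log (Zh / Zg) - KL := by
    rw [hμ, integral_congr_ae hw, integral_sub (integrable_const _) hlint, hKL']
    simp
  have hfin : ∀ᵐ x ∂G, |Real.log (wt x) - μ| ≤ l x + 2 * r x + KL := by
    filter_upwards [hw, hbd] with x h1 h2
    rw [h1, hμ', abs_le]
    have := hr0 x
    constructor <;> linarith
  have hi1 : Integrable (fun x => l x + 2 * r x) G := hlint.add (hrint.const_mul 2)
  have hi : Integrable (fun x => l x + 2 * r x + KL) G := hi1.add (integrable_const KL)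
  have hle := integral_mono_of_nonneg
    (Filter.Eventually.of_forall fun x => abs_nonneg (Real.log (wt x) - μ)) hi hfin
  rw [integral_add hi1 (integrable_const KL), integral_add hlint (hrint.const_mul 2),
    integral_const_mul, hKL'] at hle
  simp at hle
  linarith
end

section
/- Let p(x, y) be a joint probability density on 𝒳 × 𝒴 with respect to a product of σ-finite measures, with marginal p(y) = ∫_𝒳 p(x, y) dx and conditional p(x | y) = p(x, y)/p(y), and let q'(x; y) be, for each y, a probability density on 𝒳 with all the relevant Kullback–Leibler divergences finite and p(· | y) mutually absolutely continuous with q'(·; y). Define the Monte Carlo lower bound Ȟ_Y := E[log(q'(X'; Y)/p(X', Y))] where (X', Y) ∼ p(x, y). Then H(Y) − Ȟ_Y = E_{Y∼p}[KL(p(· | Y) ‖ q'(·; Y))] ≥ 0, where H(Y) := −∫ log p(y) · p(y) dy is the differential (or discrete) entropy of Y. In particular, joint samples (X', Y) ∼ p(x, y) suffice to lower-bound the entropy H(Y). -/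
open MeasureTheory

/-- Estimation gap of the Monte Carlo lower bound on entropy: with joint density `p` on
`𝒳 × 𝒴`, marginal `p(y)`, conditional `p(x|y) = p(x,y)/p(y)` and proposal densities
`q'(·; y)` mutually absolutely continuous with `p(·|y)` with all relevant KL divergences
finite, the lower bound `Ȟ_Y := E[log (q'(X';Y)/p(X',Y))]` (with `(X',Y) ∼ p(x,y)`, so
joint samples suffice) satisfies
`H(Y) − Ȟ_Y = E_{Y∼p}[KL(p(·|Y) ‖ q'(·;Y))] ≥ 0`, where `H(Y) = −∫ log p(y) · p(y) dy`. -/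
theorem entropy_lower_bound_gap
    {𝒳 𝒴 : Type*} [MeasurableSpace 𝒳] [MeasurableSpace 𝒴]
    (μX : Measure 𝒳) [SigmaFinite μX] (μY : Measure 𝒴) [SigmaFinite μY]
    (p : 𝒳 × 𝒴 → ℝ) (q' : 𝒳 → 𝒴 → ℝ)
    (hp_meas : Measurable p) (hp_nonneg : ∀ z, 0 ≤ p z)
    (hp_prob : ∫⁻ z, ENNReal.ofReal (p z) ∂(μX.prod μY) = 1)
    (hq'_meas : Measurable (Function.uncurry q'))
    (hq'_nonneg : ∀ x y, 0 ≤ q' x y)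
    (hq'_prob : ∀ y : 𝒴, ∫⁻ x, ENNReal.ofReal (q' x y) ∂μX = 1)
    (py : 𝒴 → ℝ) (hpy : ∀ y, py y = ∫ x, p (x, y) ∂μX)
    (kl : 𝒴 → ℝ)
    (hkl : ∀ y, kl y =
      ∫ x, Real.log ((p (x, y) / py y) / q' x y) * (p (x, y) / py y) ∂μX)
    (hac1 : ∀ y, 0 < py y →
      μX.withDensity (fun x => ENNReal.ofReal (p (x, y) / py y)) ≪
        μX.withDensity (fun x => ENNReal.ofReal (q' x y)))
    (hac2 : ∀ y, 0 < py y →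
      μX.withDensity (fun x => ENNReal.ofReal (q' x y)) ≪
        μX.withDensity (fun x => ENNReal.ofReal (p (x, y) / py y)))
    (hkl_fin : ∀ y, 0 < py y →
      Integrable
        (fun x => Real.log ((p (x, y) / py y) / q' x y) * (p (x, y) / py y)) μX)
    (hH_fin : Integrable (fun y => Real.log (py y) * py y) μY)
    (hkl_out : Integrable (fun y => kl y * py y) μY)
    (hjoint_fin :
      Integrable (fun z : 𝒳 × 𝒴 => Real.log (q' z.1 z.2 / p z) * p z) (μX.prod μY))
    (HY : ℝ) (hHY : HY = -∫ y, Real.log (py y) * py y ∂μY)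
    (Hcheck : ℝ)
    (hHcheck : Hcheck =
      ∫ z : 𝒳 × 𝒴, Real.log (q' z.1 z.2 / p z) * p z ∂(μX.prod μY)) :
    HY - Hcheck = ∫ y, kl y * py y ∂μY ∧ 0 ≤ ∫ y, kl y * py y ∂μY := by
  have hpI : Integrable p (μX.prod μY) := by
    refine ⟨hp_meas.aestronglyMeasurable, ?_⟩
    rw [hasFiniteIntegral_iff_ofReal (Filter.Eventually.of_forall hp_nonneg), hp_prob]
    exact ENNReal.one_lt_top
  have hpy0 : ∀ y, 0 ≤ py y := fun y => by
    rw [hpy]; exact integral_nonneg fun x => hp_nonneg _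
  have hpyI : ∀ y, 0 < py y → Integrable (fun x => p (x, y)) μX := by
    intro y hy
    by_contra h
    rw [hpy, integral_undef h] at hy
    exact lt_irrefl _ hy
  have hqm : ∀ y, Measurable (fun x => q' x y) := fun y =>
    hq'_meas.comp (measurable_id.prodMk measurable_const)
  have hpm : ∀ y, Measurable (fun x => p (x, y)) := fun y =>
    hp_meas.comp (measurable_id.prodMk measurable_const)
  have hpos : ∀ y, 0 < py y → ∀ᵐ x ∂μX, p (x, y) ≠ 0 → q' x y ≠ 0 := by
    intro y hy
    have hS : MeasurableSet {x | q' x y = 0} := hqm y (measurableSet_singleton 0)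
    have h1 : μX.withDensity (fun x => ENNReal.ofReal (q' x y)) {x | q' x y = 0} = 0 := by
      rw [withDensity_apply_eq_zero (hqm y).ennreal_ofReal]
      convert measure_empty (μ := μX)
      ext x
      simp only [ne_eq, ENNReal.ofReal_eq_zero, not_le, Set.mem_inter_iff, Set.mem_ofPred_eq,
        Set.mem_empty_iff_false, iff_false, not_and]
      exact fun h => h.ne'
    have h2 := hac1 y hy h1
    rw [withDensity_apply_eq_zero ((hpm y).div_const _).ennreal_ofReal] at h2
    rw [ae_iff]
    refine measure_mono_null ?_ h2
    intro x hx
    simp only [Set.mem_ofPred_eq, not_forall, not_not] at hx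
    obtain ⟨ha, hb⟩ := hx
    refine ⟨?_, hb⟩
    have : 0 < p (x, y) / py y := div_pos (lt_of_le_of_ne (hp_nonneg _) (Ne.symm ha)) hy
    simpa using this
  have hslice : ∀ᵐ y ∂μY, ∫ x, Real.log (q' x y / p (x, y)) * p (x, y) ∂μX
      = -(Real.log (py y) * py y) - kl y * py y := by
    filter_upwards [hpI.prod_left_ae] with y hyI
    rcases (hpy0 y).eq_or_lt with hy | hy
    · have h0 : ∫ x, p (x, y) ∂μX = 0 := by rw [← hpy, ← hy]
      rw [integral_eq_zero_iff_of_nonneg (fun x => hp_nonneg _) hyI] at h0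
      rw [← hy]
      simp only [mul_zero, neg_zero, sub_zero]
      apply integral_eq_zero_of_ae
      filter_upwards [h0] with x hx
      have hx' : p (x, y) = 0 := hx
      simp [hx']
    · have e : (fun x => Real.log (q' x y / p (x, y)) * p (x, y)) =ᵐ[μX]
          fun x => -(Real.log (py y) * p (x, y)) -
            Real.log ((p (x, y) / py y) / q' x y) * (p (x, y) / py y) * py y := by
        filter_upwards [hpos y hy] with x hx
        by_cases hp : p (x, y) = 0
        · simp [hp]
        · have hq := hx hp
          rw [Real.log_div hq hp, Real.log_div (div_ne_zero hp hy.ne') hq,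
            Real.log_div hp hy.ne']
          have := hy.ne'
          field_simp
          ring
      have hn : Integrable (fun x => -(Real.log (py y) * p (x, y))) μX := (hyI.const_mul _).neg
      rw [integral_congr_ae e, integral_sub hn ((hkl_fin y hy).mul_const _),
        integral_neg, integral_const_mul, integral_mul_const, ← hkl, ← hpy]
  have hklnn : ∀ y, 0 < py y → 0 ≤ kl y := by
    intro y hy
    have hqI : Integrable (fun x => q' x y) μX := by
      refine ⟨(hqm y).aestronglyMeasurable, ?_⟩
      rw [hasFiniteIntegral_iff_ofReal (Filter.Eventually.of_forall fun x => hq'_nonneg x y),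
        hq'_prob]
      exact ENNReal.one_lt_top
    have hq1 : ∫ x, q' x y ∂μX = 1 := by
      rw [integral_eq_lintegral_of_nonneg_ae (Filter.Eventually.of_forall fun x => hq'_nonneg x y)
        (hqm y).aestronglyMeasurable, hq'_prob]
      simp
    have hr1 : ∫ x, p (x, y) / py y ∂μX = 1 := by
      rw [integral_div, ← hpy, div_self hy.ne']
    have h0 : ∫ x, (p (x, y) / py y - q' x y) ∂μX = 0 := by
      rw [integral_sub ((hpyI y hy).div_const _) hqI, hr1, hq1, sub_self]
    rw [hkl, ← h0]
    refine integral_mono_ae (((hpyI y hy).div_const _).sub hqI) (hkl_fin y hy) ?_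
    filter_upwards [hpos y hy] with x hx
    by_cases hp : p (x, y) = 0
    · simp [hp, hq'_nonneg]
    · have hq : 0 < q' x y := lt_of_le_of_ne (hq'_nonneg x y) (Ne.symm (hx hp))
      have hr : 0 < p (x, y) / py y :=
        div_pos (lt_of_le_of_ne (hp_nonneg _) (Ne.symm hp)) hy
      generalize p (x, y) / py y = r at hr
      have h := Real.one_sub_inv_le_log_of_pos (div_pos hr hq)
      have h' := mul_le_mul_of_nonneg_right h hr.le
      have : (1 - (r / q' x y)⁻¹) * r = r - q' x y := by
        field_simp
      linarith
  refine ⟨?_, ?_⟩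
  · have hn : Integrable (fun y => -(Real.log (py y) * py y)) μY := hH_fin.neg
    rw [hHY, hHcheck, integral_prod_symm _ hjoint_fin, integral_congr_ae hslice,
      integral_sub hn hkl_out, integral_neg]
    ring
  · refine integral_nonneg fun y => ?_
    rcases (hpy0 y).eq_or_lt with hy | hy
    · simp [← hy]
    · exact mul_nonneg (hklnn y hy) hy.le
end
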